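/- Let n be a nonnegative integer and let q, α, c be complex numbers with q ≠ 0, c ≠ 0, α ≠ 1, and such that (q;q)_n, (αq;q)_n, (αc;q)_n and (q²/c;q)_n are all nonzero. Then Σ_{k=0}^{n} [(q^{−n};q)_k (α q^{n+1};q)_k (q/c;q)_k / ((q;q)_k (q²/c;q)_k)] q^k = ((αc;q)_n (q;q)_n / ((q²/c;q)_n (αq;q)_n)) · (q/c)^n · Σ_{j=0}^{n} [(1 − α q^{2j}) (α;q)_j (q/c;q)_j / ((1 − α) (q;q)_j (αc;q)_j)] (αc)^j q^{j²−j}. -/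

import Mathlib

/-- Finite q-Pochhammer symbol `(x; q)_n`. -/
noncomputable def qPoch (x q : ℂ) (n : ℕ) : ℂ := ∏ k ∈ Finset.range n, (1 - x * q ^ k)

theorem qPoch_zero (x q : ℂ) : qPoch x q 0 = 1 := by simp [qPoch]

theorem qPoch_succ (x q : ℂ) (n : ℕ) : qPoch x q (n + 1) = qPoch x q n * (1 - x * q ^ n) := by
  simp [qPoch, Finset.prod_range_succ]

theorem qPoch_succ_left (x q : ℂ) (n : ℕ) :
    qPoch x q (n + 1) = (1 - x) * qPoch (x * q) q n := by
  simp only [qPoch, Finset.prod_range_succ', pow_zero, mul_one, mul_comm (1 - x)]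
  congr 1
  exact Finset.prod_congr rfl fun k _ => by ring

theorem qPoch_ne_zero_of_le {x q : ℂ} {k n : ℕ} (hkn : k ≤ n) (h : qPoch x q n ≠ 0) :
    qPoch x q k ≠ 0 := by
  rw [qPoch, Finset.prod_ne_zero_iff] at h ⊢
  exact fun i hi => h i (Finset.range_subset_range.2 hkn hi)

theorem qPoch_inv_pow_succ {q : ℂ} (hq : q ≠ 0) (n : ℕ) :
    qPoch (q ^ n)⁻¹ q (n + 1) = 0 := by
  simp [qPoch_succ, hq]

/-- Comparison of the two factorisations of `(q^{-n-1}; q)_{k+1}`. -/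
theorem qPoch_inv_pow_shift {q : ℂ} (hq : q ≠ 0) (n k : ℕ) :
    qPoch (q ^ (n + 1))⁻¹ q k * (q ^ (n + 1) - q ^ k) =
      (q ^ (n + 1) - 1) * qPoch (q ^ n)⁻¹ q k := by
  have h := (qPoch_succ (q ^ (n + 1))⁻¹ q k).symm.trans (qPoch_succ_left _ q k)
  have e : (q ^ (n + 1))⁻¹ * q = (q ^ n)⁻¹ := by rw [pow_succ]; field_simp
  rw [e] at h
  have hn : q ^ (n + 1) ≠ 0 := pow_ne_zero _ hq
  generalize qPoch (q ^ (n + 1))⁻¹ q k = A at *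
  generalize qPoch (q ^ n)⁻¹ q k = B at *
  field_simp at h
  linear_combination h

/-- The `q`-Chu–Vandermonde sum with vanishing lower parameter. -/
theorem sum_qPoch_vandermonde {q : ℂ} (hq : q ≠ 0) (n : ℕ) (h : qPoch q q n ≠ 0) (b : ℂ) :
    ∑ k ∈ Finset.range (n + 1), qPoch (q ^ n)⁻¹ q k * qPoch b q k / qPoch q q k * q ^ k
      = b ^ n := by
  induction n generalizing b with
  | zero => simp [qPoch_zero]
  | succ n ih =>
    have hn := qPoch_ne_zero_of_le n.le_succ h
    have key : ∀ k ∈ Finset.range (n + 1),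
        qPoch (q ^ (n + 1))⁻¹ q (k + 1) * qPoch b q (k + 1) / qPoch q q (k + 1) * q ^ (k + 1) =
        qPoch (q ^ n)⁻¹ q (k + 1) * qPoch b q (k + 1) / qPoch q q (k + 1) * q ^ (k + 1) -
          (q ^ n)⁻¹ * (1 - b) *
            (qPoch (q ^ n)⁻¹ q k * qPoch (b * q) q k / qPoch q q k * q ^ k) := by
      intro k hk
      have hk1 : qPoch q q (k + 1) ≠ 0 :=
        qPoch_ne_zero_of_le (Finset.mem_range.1 hk) h
      have e : (q ^ (n + 1))⁻¹ * q = (q ^ n)⁻¹ := by rw [pow_succ]; field_simp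
      rw [qPoch_succ_left (q ^ (n + 1))⁻¹, e, qPoch_succ (q ^ n)⁻¹, qPoch_succ_left b]
      rw [qPoch_succ] at hk1 ⊢
      have ha := left_ne_zero_of_mul hk1
      have hb := right_ne_zero_of_mul hk1
      field_simp
      ring
    rw [Finset.sum_range_succ', Finset.sum_congr rfl key, Finset.sum_sub_distrib,
      ← Finset.mul_sum, ih hn (b * q)]
    have e := Finset.sum_range_succ'
      (fun k => qPoch (q ^ n)⁻¹ q k * qPoch b q k / qPoch q q k * q ^ k) (n + 1)
    rw [Finset.sum_range_succ, ih hn b, qPoch_inv_pow_succ hq] at e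
    simp only [qPoch_zero] at e ⊢
    have hqn : q ^ n ≠ 0 := pow_ne_zero _ hq
    have e2 : (q ^ n)⁻¹ * (1 - b) * (b * q) ^ n = (1 - b) * b ^ n := by
      rw [mul_pow]; field_simp
    rw [e2]
    linear_combination -e

/-- The coefficients of the partial fraction expansion of the terminating `₃φ₂` series. -/
noncomputable def pfCoeff (α q : ℂ) (n k : ℕ) : ℂ :=
  qPoch (α * q) q n / (qPoch q q n * q ^ n) *
    (qPoch (q ^ n)⁻¹ q k * qPoch (α * q ^ (n + 1)) q k / qPoch q q k * q ^ k)

theorem sum_pfCoeff {q : ℂ} (hq : q ≠ 0) (α : ℂ) (n : ℕ) (h : qPoch q q n ≠ 0) :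
    ∑ k ∈ Finset.range (n + 1), pfCoeff α q n k =
      qPoch (α * q) q n / qPoch q q n * α ^ n * q ^ (n * n) := by
  simp only [pfCoeff]
  rw [← Finset.mul_sum, sum_qPoch_vandermonde hq n h]
  field_simp
  ring

theorem pfCoeff_succ_right_eq_zero {q : ℂ} (hq : q ≠ 0) (α : ℂ) (n : ℕ) :
    pfCoeff α q n (n + 1) = 0 := by
  simp [pfCoeff, qPoch_inv_pow_succ hq]

theorem pfCoeff_succ_left {q : ℂ} (hq : q ≠ 0) (α : ℂ) (n k : ℕ) (h : qPoch q q (n + 1) ≠ 0) :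
    (q ^ (k + 1) - q ^ (n + 2)) * pfCoeff α q (n + 1) k =
      (1 - α * q ^ (n + k + 1)) * pfCoeff α q n k := by
  have hs := qPoch_inv_pow_shift hq n k
  have hb := (qPoch_succ (α * q ^ (n + 1)) q k).symm.trans (qPoch_succ_left _ q k)
  have e : α * q ^ (n + 1) * q = α * q ^ (n + 1 + 1) := by ring
  rw [e] at hb
  rw [pfCoeff, pfCoeff, qPoch_succ (α * q)]
  rw [qPoch_succ] at h ⊢
  have h1 := left_ne_zero_of_mul h
  have h2 := right_ne_zero_of_mul h
  have e1 : α * q * q ^ n = α * q ^ (n + 1) := by ring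
  have e2 : q * q ^ n = q ^ (n + 1) := by ring
  rw [e1, e2]
  rw [e2] at h2
  generalize qPoch (q ^ (n + 1))⁻¹ q k = A at *
  generalize qPoch (q ^ n)⁻¹ q k = B at *
  generalize qPoch (α * q ^ (n + 1 + 1)) q k = C at *
  generalize qPoch (α * q ^ (n + 1)) q k = D at *
  by_cases hk : qPoch q q k = 0
  · simp [hk]
  have hqn : q ^ n ≠ 0 := pow_ne_zero _ hq
  have key : (q ^ (k + 1) - q ^ (n + 2)) * ((1 - α * q ^ (n + 1)) * (A * C)) =
      (1 - q ^ (n + 1)) * q * ((1 - α * q ^ (n + k + 1)) * (B * D)) := by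
    linear_combination (-q * (1 - α * q ^ (n + 1)) * C) * hs - (1 - q ^ (n + 1)) * q * B * hb
  have hq1 : q ^ (n + 1) = q ^ n * q := pow_succ _ _
  calc _ = ((q ^ (k + 1) - q ^ (n + 2)) * ((1 - α * q ^ (n + 1)) * (A * C))) *
        (qPoch (α * q) q n * q ^ k /
          (qPoch q q n * (1 - q ^ (n + 1)) * (q ^ n * q) * qPoch q q k)) := by
        rw [← hq1]; field_simp
    _ = _ := by
        rw [key]; field_simp

/-- First-order recurrence for the partial fraction sum. -/
theorem sum_pfCoeff_div_succ {q : ℂ} (hq : q ≠ 0) (α x : ℂ) (n : ℕ)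
    (h : qPoch q q (n + 1) ≠ 0) (hx : qPoch (x * q) q (n + 2) ≠ 0) :
    (1 - x * q ^ (n + 2)) *
        ∑ k ∈ Finset.range (n + 2), pfCoeff α q (n + 1) k / (1 - x * q ^ (k + 1)) =
      (x - α * q ^ n) * ∑ k ∈ Finset.range (n + 1), pfCoeff α q n k / (1 - x * q ^ (k + 1)) +
        (1 - α * q ^ (2 * (n + 1))) * qPoch (α * q) q n / qPoch q q (n + 1) *
          α ^ (n + 1) * q ^ ((n + 1) * n) := by
  have e : ∀ x : ℂ, ∑ k ∈ Finset.range (n + 2), pfCoeff α q n k / (1 - x * q ^ (k + 1)) =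
      ∑ k ∈ Finset.range (n + 1), pfCoeff α q n k / (1 - x * q ^ (k + 1)) := by
    intro x
    simp [Finset.sum_range_succ _ (n + 1), pfCoeff_succ_right_eq_zero hq]
  have e0 := e 0
  simp only [zero_mul, sub_zero, div_one] at e0
  have key : (1 - x * q ^ (n + 2)) *
        ∑ k ∈ Finset.range (n + 2), pfCoeff α q (n + 1) k / (1 - x * q ^ (k + 1)) -
      (x - α * q ^ n) * ∑ k ∈ Finset.range (n + 2), pfCoeff α q n k / (1 - x * q ^ (k + 1)) =
      ∑ k ∈ Finset.range (n + 2), pfCoeff α q (n + 1) k +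
        α * q ^ n * ∑ k ∈ Finset.range (n + 2), pfCoeff α q n k := by
    rw [Finset.mul_sum, Finset.mul_sum, Finset.mul_sum, ← Finset.sum_sub_distrib,
      ← Finset.sum_add_distrib]
    refine Finset.sum_congr rfl fun k hk => ?_
    rw [qPoch, Finset.prod_ne_zero_iff] at hx
    have hk' : 1 - x * q ^ (k + 1) ≠ 0 := by
      have := hx k hk
      rwa [mul_assoc, ← pow_succ'] at this
    have hr := pfCoeff_succ_left hq α n k h
    rw [← mul_div_assoc, ← mul_div_assoc, ← sub_div, div_eq_iff hk']
    linear_combination x * hr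
  rw [e, e0, sum_pfCoeff hq α n (qPoch_ne_zero_of_le n.le_succ h), sum_pfCoeff hq α (n + 1) h]
    at key
  rw [sub_eq_iff_eq_add'] at key
  rw [key]
  congr 1
  rw [qPoch_succ (α * q)]
  rw [qPoch_succ] at h ⊢
  have h1 := left_ne_zero_of_mul h
  have h2 := right_ne_zero_of_mul h
  field_simp
  ring

/-- The partial fraction sum as a truncated very-well-poised series. -/
theorem sum_pfCoeff_div {q α c : ℂ} (hq : q ≠ 0) (hc : c ≠ 0) (hα : α ≠ 1) (n : ℕ)
    (h : qPoch q q n ≠ 0) (h3 : qPoch (α * c) q n ≠ 0) (hx : qPoch (q / c) q (n + 1) ≠ 0) :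
    ∑ k ∈ Finset.range (n + 1), pfCoeff α q n k / (1 - c⁻¹ * q ^ (k + 1)) =
      qPoch (α * c) q n / (qPoch (q / c) q (n + 1) * c ^ n) *
      ∑ j ∈ Finset.range (n + 1),
        ((1 - α * q ^ (2 * j)) * qPoch α q j * qPoch (q / c) q j /
          ((1 - α) * qPoch q q j * qPoch (α * c) q j)) *
        (α * c) ^ j * q ^ (j * (j - 1)) := by
  have hα' : 1 - α ≠ 0 := sub_ne_zero.2 hα.symm
  induction n with
  | zero =>
    simp [pfCoeff, qPoch_zero, qPoch_succ, hα', div_eq_mul_inv, mul_comm]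
  | succ n ih =>
    have ih := ih (qPoch_ne_zero_of_le n.le_succ h) (qPoch_ne_zero_of_le n.le_succ h3)
      (qPoch_ne_zero_of_le (n + 1).le_succ hx)
    have e : c⁻¹ * q = q / c := by ring
    have hr := sum_pfCoeff_div_succ hq α c⁻¹ n h (by rwa [e])
    rw [ih] at hr
    have hx' := hx
    rw [qPoch_succ] at hx'
    have hx1 := left_ne_zero_of_mul hx'
    have hx2 := right_ne_zero_of_mul hx'
    have e2 : 1 - q / c * q ^ (n + 1) = 1 - c⁻¹ * q ^ (n + 2) := by ring
    rw [e2] at hx2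
    apply mul_left_cancel₀ hx2
    rw [hr, Finset.sum_range_succ _ (n + 1), qPoch_succ_left α, qPoch_succ _ _ (n + 1), e2]
    rw [qPoch_succ (α * c)] at h3 ⊢
    have h31 := left_ne_zero_of_mul h3
    have h32 := right_ne_zero_of_mul h3
    have e3 : c⁻¹ - α * q ^ n = (1 - α * c * q ^ n) / c := by field_simp
    rw [e3, Nat.add_sub_cancel]
    generalize Finset.sum (M := ℂ) (Finset.range (n + 1)) _ = S
    generalize 1 - c⁻¹ * q ^ (n + 2) = X at *
    generalize 1 - α * c * q ^ n = Y at *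
    generalize qPoch (q / c) q (n + 1) = Z at *
    generalize qPoch (α * c) q n = A at *
    field_simp
    ring


/-- Lemma 2.6 of the paper: a terminated ₃φ₂ evaluation. -/
theorem statement4 (n : ℕ) (q α c : ℂ)
    (hq : q ≠ 0) (hc : c ≠ 0) (hα1 : α ≠ 1)
    (h1 : qPoch q q n ≠ 0) (h2 : qPoch (α * q) q n ≠ 0) (h3 : qPoch (α * c) q n ≠ 0)
    (h4 : qPoch (q ^ 2 / c) q n ≠ 0) :
    ∑ k ∈ Finset.range (n + 1),
      qPoch (q ^ (-(n : ℤ))) q k * qPoch (α * q ^ (n + 1)) q k * qPoch (q / c) q k /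
        (qPoch q q k * qPoch (q ^ 2 / c) q k) * q ^ k
    = (qPoch (α * c) q n * qPoch q q n / (qPoch (q ^ 2 / c) q n * qPoch (α * q) q n)) *
      (q / c) ^ n *
      ∑ j ∈ Finset.range (n + 1),
        ((1 - α * q ^ (2 * j)) * qPoch α q j * qPoch (q / c) q j /
          ((1 - α) * qPoch q q j * qPoch (α * c) q j)) *
        (α * c) ^ j * q ^ (j * (j - 1)) := by
  have hk0 : ∀ k ∈ Finset.range (n + 1), qPoch (q ^ 2 / c) q k ≠ 0 := fun k hk =>
    qPoch_ne_zero_of_le (Nat.lt_succ_iff.1 (Finset.mem_range.1 hk)) h4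
  have e : q / c * q = q ^ 2 / c := by ring
  rw [zpow_neg, zpow_natCast]
  by_cases hqc : q / c = 1
  · have hv : ∀ k, qPoch 1 q (k + 1) = 0 := fun k => by simp [qPoch_succ_left]
    have hcq : c = q := ((div_eq_one_iff_eq hc).1 hqc).symm
    have e' : q ^ 2 / c = q := by rw [← e, hqc, one_mul]
    have hα' : 1 - α ≠ 0 := sub_ne_zero.2 hα1.symm
    rw [Finset.sum_range_succ', Finset.sum_range_succ', hqc, e', hcq]
    simp [hv, qPoch_zero]
    field_simp
  · have hx : qPoch (q / c) q (n + 1) ≠ 0 := by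
      rw [qPoch_succ_left, e]
      exact mul_ne_zero (sub_ne_zero.2 (Ne.symm hqc)) h4
    have key := sum_pfCoeff_div hq hc hα1 n h1 h3 hx
    rw [qPoch_succ_left, e] at key
    have hqc' : 1 - q / c ≠ 0 := sub_ne_zero.2 (Ne.symm hqc)
    have hL : ∑ k ∈ Finset.range (n + 1),
        qPoch (q ^ n)⁻¹ q k * qPoch (α * q ^ (n + 1)) q k * qPoch (q / c) q k /
          (qPoch q q k * qPoch (q ^ 2 / c) q k) * q ^ k =
        (1 - q / c) * (qPoch q q n * q ^ n / qPoch (α * q) q n) *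
          ∑ k ∈ Finset.range (n + 1), pfCoeff α q n k / (1 - c⁻¹ * q ^ (k + 1)) := by
      rw [Finset.mul_sum]
      refine Finset.sum_congr rfl fun k hk => ?_
      have hs := (qPoch_succ (q / c) q k).symm.trans (qPoch_succ_left _ q k)
      have e1 : 1 - q / c * q ^ k = 1 - c⁻¹ * q ^ (k + 1) := by ring
      have hne : 1 - c⁻¹ * q ^ (k + 1) ≠ 0 := by
        have := qPoch_ne_zero_of_le (Finset.mem_range.1 hk) hx
        rw [qPoch_succ, e1] at this
        exact right_ne_zero_of_mul this
      have hqk : qPoch q q k ≠ 0 :=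
        qPoch_ne_zero_of_le (Nat.lt_succ_iff.1 (Finset.mem_range.1 hk)) h1
      have h4k := hk0 k hk
      rw [e, e1, ← eq_div_iff hne] at hs
      rw [hs, pfCoeff]
      generalize 1 - c⁻¹ * q ^ (k + 1) = X at *
      generalize 1 - q / c = Y at *
      field_simp
    rw [hL, key, div_pow]
    generalize Finset.sum (M := ℂ) (Finset.range (n + 1)) _ = S
    generalize 1 - q / c = Y at *
    field_simp
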